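/- arXiv:1804.08106 — 5 statements merged into one kernel-verified Lean document; each statement's English description precedes it below -/
import Mathlib

section
/- Under the hypotheses of the context, x is a ℤ_p-analytic vector. More precisely: the iterated logarithms (log τ)^i(x) are well-defined for every i ≥ 1 (the series defining (log τ)(y) converges at each successive stage y = (log τ)^{i−1}(x)); the norms ‖(log τ)^i(x)/i!‖ tend to 0 as i → ∞; and for every a ∈ ℤ_p the series Σ_{i≥0} a^i·(log τ)^i(x)/i! converges in W with sum τ^a(x). In particular there exists a sequence (x_i)_{i≥0} in W tending to 0 such that τ^a(x) = Σ_{i≥0} a^i·x_i for every a ∈ ℤ_p. -/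
open Filter

section PadicPowerSeries

variable {p : ℕ} [Fact p.Prime] {W : Type*} [NormedAddCommGroup W] [NormedSpace ℚ_[p] W]

lemma nonpos_of_forall_le_norm_mul {t M : ℝ} (h : ∀ b : ℤ_[p], b ≠ 0 → t ≤ ‖b‖ * M) : t ≤ 0 := by
  have hp := (Fact.out : p.Prime)
  have hlim : Tendsto (fun n : ℕ => ((p : ℝ)⁻¹) ^ n * M) atTop (nhds (0 * M)) :=
    (tendsto_pow_atTop_nhds_zero_of_lt_one (by positivity)
      (inv_lt_one_of_one_lt₀ (by exact_mod_cast hp.one_lt))).mul_const M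
  rw [zero_mul] at hlim
  refine ge_of_tendsto' hlim fun n => ?_
  simpa using h ((p : ℤ_[p]) ^ n) (pow_ne_zero _ (by exact_mod_cast hp.ne_zero))

lemma PadicInt.norm_coe_pow_smul_le (a : ℤ_[p]) (i : ℕ) (w : W) :
    ‖(a : ℚ_[p]) ^ i • w‖ ≤ ‖w‖ := by
  rw [norm_smul, norm_pow]
  exact mul_le_of_le_one_left (norm_nonneg _) (pow_le_one₀ (norm_nonneg _) a.norm_le_one)

variable [CompleteSpace W]

lemma summable_padicInt_pow_smul {c : ℕ → W} (hc : Summable fun i => ‖c i‖) (a : ℤ_[p]) :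
    Summable fun i => (a : ℚ_[p]) ^ i • c i :=
  .of_norm_bounded hc fun i => PadicInt.norm_coe_pow_smul_le a i (c i)

lemma eq_zero_of_tsum_padicInt_pow_smul_eq_zero {c : ℕ → W} (hc : Summable fun i => ‖c i‖)
    (h : ∀ a : ℤ_[p], ∑' i, (a : ℚ_[p]) ^ i • c i = 0) (N : ℕ) : c N = 0 := by
  induction N using Nat.strong_induction_on with
  | _ N ih =>
    rw [← norm_le_zero_iff]
    refine nonpos_of_forall_le_norm_mul (p := p) (M := ∑' i, ‖c (i + (N + 1))‖) fun a ha => ?_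
    have hsum := (summable_padicInt_pow_smul hc a).sum_add_tsum_nat_add (N + 1)
    rw [h a, Finset.sum_range_succ, Finset.sum_eq_zero fun i hi => by
      rw [ih i (Finset.mem_range.mp hi), smul_zero], zero_add] at hsum
    have hle : ‖(a : ℚ_[p]) ^ N • c N‖ ≤ ‖a‖ ^ (N + 1) * ∑' i, ‖c (i + (N + 1))‖ := by
      rw [eq_neg_of_add_eq_zero_left hsum, norm_neg]
      refine tsum_of_norm_bounded
        (((summable_nat_add_iff (N + 1)).mpr hc).hasSum.mul_left (‖a‖ ^ (N + 1))) fun i => ?_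
      rw [add_comm i, pow_add, mul_smul, norm_smul, norm_pow, PadicInt.padic_norm_e_of_padicInt]
      gcongr
      exact PadicInt.norm_coe_pow_smul_le a i _
    rw [norm_smul, norm_pow, PadicInt.padic_norm_e_of_padicInt, pow_succ, mul_assoc] at hle
    exact le_of_mul_le_mul_left hle (pow_pos (norm_pos_iff.mpr ha) N)

lemma eq_of_tsum_padicInt_pow_smul_eq {c d : ℕ → W} (hc : Summable fun i => ‖c i‖)
    (hd : Summable fun i => ‖d i‖)
    (h : ∀ a : ℤ_[p], ∑' i, (a : ℚ_[p]) ^ i • c i = ∑' i, (a : ℚ_[p]) ^ i • d i) (N : ℕ) :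
    c N = d N := by
  refine sub_eq_zero.mp (eq_zero_of_tsum_padicInt_pow_smul_eq_zero (p := p)
    (c := fun i => c i - d i)
    (.of_nonneg_of_le (fun _ => norm_nonneg _) (fun i => norm_sub_le _ _) (hc.add hd))
    (fun a => ?_) N)
  simp_rw [smul_sub]
  rw [(summable_padicInt_pow_smul hc a).tsum_sub (summable_padicInt_pow_smul hd a), h a, sub_self]

lemma norm_tsum_padicInt_add_pow_smul_sub_le {c : ℕ → W} (hc : Summable fun i => ‖c i‖)
    (hc' : Summable fun i : ℕ => ‖((i : ℚ_[p]) + 1) • c (i + 1)‖) (a b : ℤ_[p]) :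
    ‖(∑' i, ((a + b : ℤ_[p]) : ℚ_[p]) ^ i • c i) - (∑' i, (a : ℚ_[p]) ^ i • c i)
        - (b : ℚ_[p]) • ∑' i : ℕ, (a : ℚ_[p]) ^ i • ((i : ℚ_[p]) + 1) • c (i + 1)‖
      ≤ ‖b‖ ^ 2 * ∑' i, ‖c i‖ := by
  have hder : HasSum (fun i : ℕ => ((i : ℚ_[p]) * (a : ℚ_[p]) ^ (i - 1)) • c i)
      (∑' i : ℕ, (a : ℚ_[p]) ^ i • ((i : ℚ_[p]) + 1) • c (i + 1)) := by
    rw [← hasSum_nat_add_iff' 1]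
    simpa [smul_smul, mul_comm] using (summable_padicInt_pow_smul hc' a).hasSum
  have hsum := (((summable_padicInt_pow_smul hc (a + b)).hasSum.sub
    (summable_padicInt_pow_smul hc a).hasSum).sub (hder.const_smul (b : ℚ_[p])))
  rw [← hsum.tsum_eq]
  refine tsum_of_norm_bounded (hc.hasSum.mul_left (‖b‖ ^ 2)) fun i => ?_
  obtain ⟨k, hk⟩ := Polynomial.powAddExpansion a b i
  have : ((a + b : ℤ_[p]) : ℚ_[p]) ^ i • c i - (a : ℚ_[p]) ^ i • c i
      - (b : ℚ_[p]) • ((i : ℚ_[p]) * (a : ℚ_[p]) ^ (i - 1)) • c i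
      = ((k * b ^ 2 : ℤ_[p]) : ℚ_[p]) • c i := by
    rw [smul_smul, ← sub_smul, ← sub_smul, ← PadicInt.coe_pow, hk]
    push_cast
    congr 1
    ring
  rw [this, norm_smul, PadicInt.padic_norm_e_of_padicInt, norm_mul, norm_pow]
  gcongr
  exact mul_le_of_le_one_left (by positivity) k.norm_le_one

end PadicPowerSeries

section MahlerCoefficients

/-- The coefficient of `X ^ i` in the polynomial `(-1) ^ k * (X choose k)` over `ℚ_[p]`. -/
noncomputable def signedChooseCoeff (p : ℕ) [Fact p.Prime] (k i : ℕ) : ℚ_[p] :=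
  (-1) ^ k * (k.factorial : ℚ_[p])⁻¹ * ((descPochhammer ℤ k).coeff i : ℤ)

variable {p : ℕ} [Fact p.Prime]

lemma signedChooseCoeff_eq_zero {k i : ℕ} (h : k < i) : signedChooseCoeff p k i = 0 := by
  rw [signedChooseCoeff, Polynomial.coeff_eq_zero_of_natDegree_lt (by simpa using h)]
  simp

lemma tsum_pow_mul_signedChooseCoeff (n k : ℕ) :
    ∑' i, (n : ℚ_[p]) ^ i * signedChooseCoeff p k i = (-1) ^ k * (n.choose k : ℚ_[p]) := by
  rw [tsum_eq_sum (s := Finset.range (k + 1)) fun i hi => by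
    rw [signedChooseCoeff_eq_zero (by simpa using hi), mul_zero]]
  have h := descPochhammer_eval_eq_descFactorial ℤ n k
  rw [Polynomial.eval_eq_sum_range' (n := k + 1) (by simp)] at h
  have h' := congrArg (Int.cast : ℤ → ℚ_[p]) h
  push_cast at h'
  rw [Nat.descFactorial_eq_factorial_mul_choose] at h'
  push_cast at h'
  have hk : (k.factorial : ℚ_[p]) ≠ 0 := by exact_mod_cast k.factorial_ne_zero
  calc _ = (-1) ^ k * (k.factorial : ℚ_[p])⁻¹ *
        ∑ i ∈ Finset.range (k + 1), ((descPochhammer ℤ k).coeff i : ℚ_[p]) * (n : ℚ_[p]) ^ i := by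
        rw [Finset.mul_sum]
        refine Finset.sum_congr rfl fun i _ => ?_
        rw [signedChooseCoeff]
        ring
    _ = _ := by rw [h']; field_simp

lemma signedChooseCoeff_zero_one : signedChooseCoeff p 0 1 = 0 :=
  signedChooseCoeff_eq_zero zero_lt_one

lemma descPochhammer_eval_neg_one (n : ℕ) :
    (descPochhammer ℤ n).eval (-1) = (-1) ^ n * n.factorial := by
  induction n with
  | zero => simp
  | succ n ih =>
    rw [descPochhammer_succ_right, Polynomial.eval_mul, ih, Nat.factorial_succ]
    simp only [Polynomial.eval_sub, Polynomial.eval_X, Polynomial.eval_natCast]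
    push_cast
    ring

lemma signedChooseCoeff_succ_one (k : ℕ) :
    signedChooseCoeff p (k + 1) 1 = -((k : ℚ_[p]) + 1)⁻¹ := by
  have h : (descPochhammer ℤ (k + 1)).coeff 1 = (-1) ^ k * k.factorial := by
    rw [descPochhammer_succ_left, Polynomial.coeff_X_mul, Polynomial.coeff_zero_eq_eval_zero,
      Polynomial.eval_comp, ← descPochhammer_eval_neg_one]
    simp
  have hk : (k.factorial : ℚ_[p]) ≠ 0 := by exact_mod_cast k.factorial_ne_zero
  have hk1 : (k : ℚ_[p]) + 1 ≠ 0 := by exact_mod_cast k.succ_ne_zero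
  rw [signedChooseCoeff, h, Nat.factorial_succ]
  push_cast
  have : ((-1 : ℚ_[p]) ^ k) * (-1) ^ k = 1 := by rw [← mul_pow]; simp
  field_simp
  linear_combination (-1 : ℚ_[p]) * this

lemma norm_inv_factorial_le (n : ℕ) :
    ‖(n.factorial : ℚ_[p])⁻¹‖ ≤ ((p : ℝ) ^ (1 / ((p : ℝ) - 1))) ^ n := by
  have hp := (Fact.out : p.Prime)
  have hp1 : (1 : ℝ) < p := by exact_mod_cast hp.one_lt
  have hn : (n.factorial : ℚ_[p]) ≠ 0 := by exact_mod_cast n.factorial_ne_zero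
  rw [norm_inv, Padic.norm_eq_zpow_neg_valuation hn, Padic.valuation_natCast, zpow_neg, inv_inv,
    zpow_natCast, ← Real.rpow_natCast, ← Real.rpow_natCast, ← Real.rpow_mul (by positivity)]
  refine Real.rpow_le_rpow_of_exponent_le hp1.le ?_
  have h : (p - 1) * padicValNat p n.factorial ≤ n := by
    rw [sub_one_mul_padicValNat_factorial]
    exact Nat.sub_le _ _
  have h' : ((p : ℝ) - 1) * padicValNat p n.factorial ≤ n := by
    have := (Nat.cast_le (α := ℝ)).mpr h
    rwa [Nat.cast_mul, Nat.cast_sub hp.one_le, Nat.cast_one] at this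
  rw [div_mul_eq_mul_div, one_mul, le_div_iff₀ (by linarith)]
  linarith

lemma exists_norm_signedChooseCoeff_mul_pow_le {r : ℝ} (hr0 : 0 < r)
    (hr1 : r < (p : ℝ) ^ (-(1 / ((p : ℝ) - 1)))) :
    ∃ s : ℝ, 0 < s ∧ s < 1 ∧ ∀ k i, ‖signedChooseCoeff p k i‖ * r ^ k ≤ s ^ k * s ^ i := by
  have hp : (0 : ℝ) < p := by exact_mod_cast (Fact.out : p.Prime).pos
  set P := (p : ℝ) ^ (1 / ((p : ℝ) - 1)) with hP
  have hP0 : 0 < P := by positivity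
  have hq : P * r < 1 := by
    rw [Real.rpow_neg hp.le, ← hP] at hr1
    calc P * r < P * P⁻¹ := by gcongr
      _ = 1 := mul_inv_cancel₀ hP0.ne'
  have hs0 : 0 < √(P * r) := by positivity
  have hs1 : √(P * r) < 1 := by rwa [Real.sqrt_lt' one_pos, one_pow]
  refine ⟨√(P * r), hs0, hs1, fun k i => ?_⟩
  rcases lt_or_ge k i with h | h
  · rw [signedChooseCoeff_eq_zero h, norm_zero, zero_mul]
    positivity
  · calc ‖signedChooseCoeff p k i‖ * r ^ k ≤ P ^ k * r ^ k := by
          gcongr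
          rw [signedChooseCoeff, norm_mul, norm_mul, norm_pow, norm_neg, norm_one, one_pow, one_mul]
          exact (mul_le_of_le_one_right (norm_nonneg _) (Padic.norm_int_le_one _)).trans
            (norm_inv_factorial_le k)
      _ = √(P * r) ^ k * √(P * r) ^ k := by
          rw [← mul_pow, ← mul_pow, Real.mul_self_sqrt (by positivity)]
      _ ≤ √(P * r) ^ k * √(P * r) ^ i := by
          gcongr ?_ * ?_
          exact pow_le_pow_of_le_one hs0.le hs1.le h

variable {W : Type*} [NormedAddCommGroup W] [NormedSpace ℚ_[p] W]

/-- The coefficient of `a ^ i` in the Mahler expansion `∑ (a choose k) • (-T) ^ k y`. -/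
noncomputable def mahlerCoeff (T : Module.End ℚ_[p] W) (y : W) (i : ℕ) : W :=
  ∑' k, signedChooseCoeff p k i • (T ^ k) y

variable {T : Module.End ℚ_[p] W} {r s C : ℝ} {y : W}

lemma norm_signedChooseCoeff_smul_le (hr0 : 0 < r)
    (hs : ∀ k i, ‖signedChooseCoeff p k i‖ * r ^ k ≤ s ^ k * s ^ i)
    (hy : ∀ k, ‖(T ^ k) y‖ ≤ C * r ^ k) (m k i : ℕ) :
    ‖signedChooseCoeff p k i • (T ^ (m + k)) y‖ ≤ s ^ k * (C * r ^ m * s ^ i) := by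
  have hC : 0 ≤ C := by simpa using (norm_nonneg _).trans (hy 0)
  rw [norm_smul]
  calc _ ≤ ‖signedChooseCoeff p k i‖ * (C * r ^ (m + k)) := by gcongr; exact hy _
    _ = C * r ^ m * (‖signedChooseCoeff p k i‖ * r ^ k) := by ring
    _ ≤ C * r ^ m * (s ^ k * s ^ i) :=
        mul_le_mul_of_nonneg_left (hs k i) (by positivity)
    _ = _ := by ring

variable [CompleteSpace W]

lemma hasSum_mahlerCoeff (hr0 : 0 < r) (hs0 : 0 < s) (hs1 : s < 1)
    (hs : ∀ k i, ‖signedChooseCoeff p k i‖ * r ^ k ≤ s ^ k * s ^ i)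
    (hy : ∀ k, ‖(T ^ k) y‖ ≤ C * r ^ k) (i : ℕ) :
    HasSum (fun k => signedChooseCoeff p k i • (T ^ k) y) (mahlerCoeff T y i) := by
  refine Summable.hasSum (.of_norm_bounded
    ((summable_geometric_of_lt_one hs0.le hs1).mul_right (C * r ^ 0 * s ^ i)) fun k => ?_)
  simpa using norm_signedChooseCoeff_smul_le hr0 hs hy 0 k i

lemma hasSum_log (hr0 : 0 < r) (hs0 : 0 < s) (hs1 : s < 1)
    (hs : ∀ k i, ‖signedChooseCoeff p k i‖ * r ^ k ≤ s ^ k * s ^ i)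
    (hy : ∀ k, ‖(T ^ k) y‖ ≤ C * r ^ k) :
    HasSum (fun k : ℕ => -(((k : ℚ_[p]) + 1)⁻¹ • (T ^ (k + 1)) y)) (mahlerCoeff T y 1) := by
  have h := (hasSum_nat_add_iff' 1).mpr (hasSum_mahlerCoeff hr0 hs0 hs1 hs hy 1)
  simpa [signedChooseCoeff_zero_one, signedChooseCoeff_succ_one] using h

lemma norm_pow_mahlerCoeff_le (hT : Continuous T) (hr0 : 0 < r) (hs0 : 0 < s) (hs1 : s < 1)
    (hs : ∀ k i, ‖signedChooseCoeff p k i‖ * r ^ k ≤ s ^ k * s ^ i)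
    (hy : ∀ k, ‖(T ^ k) y‖ ≤ C * r ^ k) (m i : ℕ) :
    ‖(T ^ m) (mahlerCoeff T y i)‖ ≤ (1 - s)⁻¹ * (C * r ^ m * s ^ i) := by
  have hTm : Continuous (T ^ m) := by
    rw [Module.End.coe_pow]
    exact hT.iterate m
  have h := (hasSum_mahlerCoeff hr0 hs0 hs1 hs hy i).map (T ^ m) hTm
  rw [← h.tsum_eq]
  refine tsum_of_norm_bounded ((hasSum_geometric_of_lt_one hs0.le hs1).mul_right _) fun k => ?_
  simpa [pow_add] using norm_signedChooseCoeff_smul_le hr0 hs hy m k i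

lemma summable_norm_mahlerCoeff (hT : Continuous T) (hr0 : 0 < r) (hs0 : 0 < s) (hs1 : s < 1)
    (hs : ∀ k i, ‖signedChooseCoeff p k i‖ * r ^ k ≤ s ^ k * s ^ i)
    (hy : ∀ k, ‖(T ^ k) y‖ ≤ C * r ^ k) : Summable fun i => ‖mahlerCoeff T y i‖ := by
  refine .of_nonneg_of_le (fun _ => norm_nonneg _)
    (fun i => norm_pow_mahlerCoeff_le hT hr0 hs0 hs1 hs hy 0 i)
    (((summable_geometric_of_lt_one hs0.le hs1).mul_left _).mul_left _)

lemma tsum_natCast_pow_smul_mahlerCoeff (hr0 : 0 < r) (hs0 : 0 < s) (hs1 : s < 1)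
    (hs : ∀ k i, ‖signedChooseCoeff p k i‖ * r ^ k ≤ s ^ k * s ^ i)
    (hy : ∀ k, ‖(T ^ k) y‖ ≤ C * r ^ k) (n : ℕ) :
    ∑' i, (n : ℚ_[p]) ^ i • mahlerCoeff T y i = ((1 - T) ^ n) y := by
  have hsum : Summable (Function.uncurry fun k i : ℕ =>
      (n : ℚ_[p]) ^ i • signedChooseCoeff p k i • (T ^ k) y) := by
    have hg := summable_geometric_of_lt_one hs0.le hs1
    refine .of_norm_bounded ((hg.mul_of_nonneg (hg.mul_left C)
      (fun _ => by positivity) (fun i => ?_))) ?_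
    · have hC : 0 ≤ C := by simpa using (norm_nonneg _).trans (hy 0)
      simp only [Pi.zero_apply]
      positivity
    · rintro ⟨k, i⟩
      have h1 := PadicInt.norm_coe_pow_smul_le (n : ℤ_[p]) i (signedChooseCoeff p k i • (T ^ k) y)
      have h2 := norm_signedChooseCoeff_smul_le hr0 hs hy 0 k i
      simp only [zero_add, pow_zero, mul_one, PadicInt.coe_natCast] at h1 h2
      exact h1.trans h2
  have h1 : ∀ i, (n : ℚ_[p]) ^ i • mahlerCoeff T y i
      = ∑' k, (n : ℚ_[p]) ^ i • signedChooseCoeff p k i • (T ^ k) y := fun i =>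
    ((hasSum_mahlerCoeff hr0 hs0 hs1 hs hy i).const_smul _).tsum_eq.symm
  have h2 : ∀ k, ∑' i, (n : ℚ_[p]) ^ i • signedChooseCoeff p k i • (T ^ k) y
      = ((-1) ^ k * (n.choose k : ℚ_[p])) • (T ^ k) y := fun k => by
    rw [← tsum_pow_mul_signedChooseCoeff]
    simp_rw [smul_smul]
    refine Summable.tsum_smul_const (summable_of_ne_finset_zero (s := Finset.range (k + 1))
      fun i hi => ?_) _
    rw [signedChooseCoeff_eq_zero (by simpa using hi), mul_zero]
  simp_rw [h1]
  rw [hsum.tsum_comm]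
  simp_rw [h2]
  rw [tsum_eq_sum (s := Finset.range (n + 1)) fun k hk => by
    rw [Nat.choose_eq_zero_of_lt (by simpa using hk), Nat.cast_zero, mul_zero, zero_smul]]
  rw [show (1 - T) = -T + 1 by abel, ((Commute.one_right (-T)).add_pow n)]
  simp only [one_pow, mul_one, LinearMap.sum_apply]
  refine Finset.sum_congr rfl fun k _ => ?_
  rw [← nsmul_eq_mul' ((-T) ^ k), LinearMap.smul_apply, mul_comm, mul_smul,
    Nat.cast_smul_eq_nsmul]
  rcases Nat.even_or_odd k with hk | hk <;> simp [hk.neg_one_pow, hk.neg_pow]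

end MahlerCoefficients

section Action

variable {p : ℕ} [Fact p.Prime] {W : Type*} [NormedAddCommGroup W] [NormedSpace ℚ_[p] W]
  [CompleteSpace W] {ρ : ℤ_[p] → Module.End ℚ_[p] W} {r s C : ℝ} {y : W}

lemma hasSum_padicInt_pow_smul_mahlerCoeff (hρ0 : ρ 0 = 1)
    (hρadd : ∀ a b : ℤ_[p], ρ (a + b) = ρ a * ρ b)
    (hρcont : Continuous fun q : ℤ_[p] × W => ρ q.1 q.2)
    (hr0 : 0 < r) (hs0 : 0 < s) (hs1 : s < 1)
    (hs : ∀ k i, ‖signedChooseCoeff p k i‖ * r ^ k ≤ s ^ k * s ^ i)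
    (hy : ∀ k, ‖((1 - ρ 1) ^ k) y‖ ≤ C * r ^ k) (a : ℤ_[p]) :
    HasSum (fun i => (a : ℚ_[p]) ^ i • mahlerCoeff (1 - ρ 1) y i) (ρ a y) := by
  have hT : Continuous (1 - ρ 1 : Module.End ℚ_[p] W) :=
    continuous_id.sub (hρcont.comp (Continuous.prodMk_right 1))
  have hc := summable_norm_mahlerCoeff hT hr0 hs0 hs1 hs hy
  refine (summable_padicInt_pow_smul hc a).hasSum_iff.mpr ?_
  refine congrFun ((PadicInt.denseRange_natCast (p := p)).equalizer
    (g := fun a : ℤ_[p] => ∑' i, (a : ℚ_[p]) ^ i • mahlerCoeff (1 - ρ 1) y i)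
    (h := fun a : ℤ_[p] => ρ a y) ?_ (hρcont.comp (Continuous.prodMk_left y)) (funext fun n => ?_)) a
  · exact continuous_tsum (fun i => by fun_prop) hc fun i a => PadicInt.norm_coe_pow_smul_le a i _
  · have hn : ∀ n : ℕ, ρ n = ρ 1 ^ n := fun n => by
      induction n with
      | zero => simpa using hρ0
      | succ n ih => rw [Nat.cast_succ, hρadd, ih, pow_succ]
    have := tsum_natCast_pow_smul_mahlerCoeff hr0 hs0 hs1 hs hy n
    simpa [hn] using this

lemma mahlerCoeff_one_comp (hρ0 : ρ 0 = 1)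
    (hρadd : ∀ a b : ℤ_[p], ρ (a + b) = ρ a * ρ b)
    (hρiso : ∀ (a : ℤ_[p]) (w : W), ‖ρ a w‖ = ‖w‖)
    (hρcont : Continuous fun q : ℤ_[p] × W => ρ q.1 q.2)
    (hr0 : 0 < r) (hs0 : 0 < s) (hs1 : s < 1)
    (hs : ∀ k i, ‖signedChooseCoeff p k i‖ * r ^ k ≤ s ^ k * s ^ i)
    (hy : ∀ k, ‖((1 - ρ 1) ^ k) y‖ ≤ C * r ^ k) (i : ℕ) :
    mahlerCoeff (1 - ρ 1) (mahlerCoeff (1 - ρ 1) y 1) i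
      = ((i : ℚ_[p]) + 1) • mahlerCoeff (1 - ρ 1) y (i + 1) := by
  have hT : Continuous (1 - ρ 1 : Module.End ℚ_[p] W) :=
    continuous_id.sub (hρcont.comp (Continuous.prodMk_right 1))
  set c := mahlerCoeff (1 - ρ 1) y
  have hD : ∀ k, ‖((1 - ρ 1) ^ k) (c 1)‖ ≤ ((1 - s)⁻¹ * C * s) * r ^ k := fun k =>
    (norm_pow_mahlerCoeff_le hT hr0 hs0 hs1 hs hy k 1).trans_eq (by ring)
  have hc : Summable fun i => ‖c i‖ := summable_norm_mahlerCoeff hT hr0 hs0 hs1 hs hy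
  have hc' : Summable fun i : ℕ => ‖((i : ℚ_[p]) + 1) • c (i + 1)‖ := by
    refine .of_nonneg_of_le (fun _ => norm_nonneg _) (fun i => ?_)
      ((summable_nat_add_iff 1).mpr hc)
    have h := PadicInt.norm_coe_pow_smul_le ((i + 1 : ℕ) : ℤ_[p]) 1 (c (i + 1))
    rwa [PadicInt.coe_natCast, Nat.cast_succ, pow_one] at h
  have hρy : ∀ a : ℤ_[p], ∑' i, (a : ℚ_[p]) ^ i • c i = ρ a y := fun a =>
    (hasSum_padicInt_pow_smul_mahlerCoeff hρ0 hρadd hρcont hr0 hs0 hs1 hs hy a).tsum_eq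
  have happrox : ∀ a b : ℤ_[p], ‖ρ (a + b) y - ρ a y
      - (b : ℚ_[p]) • ∑' i : ℕ, (a : ℚ_[p]) ^ i • ((i : ℚ_[p]) + 1) • c (i + 1)‖
      ≤ ‖b‖ ^ 2 * ∑' i, ‖c i‖ := fun a b => by
    simpa only [hρy] using norm_tsum_padicInt_add_pow_smul_sub_le hc hc' a b
  have hzero : ∑' i : ℕ, ((0 : ℤ_[p]) : ℚ_[p]) ^ i • ((i : ℚ_[p]) + 1) • c (i + 1) = c 1 := by
    rw [tsum_eq_single 0 fun i hi => by simp [hi]]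
    simp
  refine eq_of_tsum_padicInt_pow_smul_eq (p := p)
    (summable_norm_mahlerCoeff hT hr0 hs0 hs1 hs hD) hc' (fun a => ?_) i
  rw [(hasSum_padicInt_pow_smul_mahlerCoeff hρ0 hρadd hρcont hr0 hs0 hs1 hs hD a).tsum_eq]
  rw [← sub_eq_zero, ← norm_le_zero_iff]
  refine nonpos_of_forall_le_norm_mul (p := p) (M := 2 * ∑' i, ‖c i‖) fun b hb => ?_
  have h0 := happrox 0 b
  rw [hzero, zero_add, hρ0, ← hρiso a, map_sub, map_sub, map_smul, Module.End.one_apply,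
    ← Module.End.mul_apply, ← hρadd] at h0
  have hle := (norm_sub_le _ _).trans (add_le_add (happrox a b) h0)
  rw [sub_sub_sub_cancel_left, ← smul_sub, norm_smul, PadicInt.padic_norm_e_of_padicInt] at hle
  refine le_of_mul_le_mul_left (hle.trans_eq ?_) (norm_pos_iff.mpr hb)
  ring

lemma mahlerCoeff_eq_iterate (hρ0 : ρ 0 = 1)
    (hρadd : ∀ a b : ℤ_[p], ρ (a + b) = ρ a * ρ b)
    (hρiso : ∀ (a : ℤ_[p]) (w : W), ‖ρ a w‖ = ‖w‖)
    (hρcont : Continuous fun q : ℤ_[p] × W => ρ q.1 q.2)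
    (hr0 : 0 < r) (hs0 : 0 < s) (hs1 : s < 1)
    (hs : ∀ k i, ‖signedChooseCoeff p k i‖ * r ^ k ≤ s ^ k * s ^ i)
    (hy : ∀ k, ‖((1 - ρ 1) ^ k) y‖ ≤ C * r ^ k) (i : ℕ) :
    mahlerCoeff (1 - ρ 1) y i
      = (i.factorial : ℚ_[p])⁻¹ • (fun w => mahlerCoeff (1 - ρ 1) w 1)^[i] y := by
  have hT : Continuous (1 - ρ 1 : Module.End ℚ_[p] W) :=
    continuous_id.sub (hρcont.comp (Continuous.prodMk_right 1))
  induction i generalizing y C with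
  | zero =>
    have h := (hasSum_padicInt_pow_smul_mahlerCoeff hρ0 hρadd hρcont hr0 hs0 hs1 hs hy 0).tsum_eq
    rw [tsum_eq_single 0 fun i hi => by simp [hi], hρ0] at h
    simpa using h
  | succ i ih =>
    have hi : (i : ℚ_[p]) + 1 ≠ 0 := by exact_mod_cast i.succ_ne_zero
    rw [Function.iterate_succ_apply, Nat.factorial_succ, Nat.cast_mul, mul_inv, mul_smul,
      ← ih (C := (1 - s)⁻¹ * C * s) fun k =>
        (norm_pow_mahlerCoeff_le hT hr0 hs0 hs1 hs hy k 1).trans_eq (by ring),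
      mahlerCoeff_one_comp hρ0 hρadd hρiso hρcont hr0 hs0 hs1 hs hy, Nat.cast_succ,
      inv_smul_smul₀ hi]

end Action


/-- Criterion for `ℤ_p`-analyticity (Lemma 3.13 of Gao–Poyeton): let `W` be a
nonarchimedean `ℚ_p`-Banach space with a continuous isometric action `ρ` of the additive
group `ℤ_p` (`ρ a` is `τ^a`).  If `‖(1−τ^a)^k(x)‖ ≤ R` for `k < k₀` and
`‖(1−τ^a)^k(x)‖ ≤ r^k` for `k ≥ k₀`, uniformly in `a ∈ ℤ_p`, with
`0 < r < min(1/e, p^{−1/(p−1)})`, then `x` is a `ℤ_p`-analytic vector: the iterated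
logarithms `L i = (log τ)^i(x)` are well-defined, `‖L i / i!‖ → 0`, and
`τ^a(x) = Σ_i a^i·L i/i!` for every `a ∈ ℤ_p`; in particular there is a sequence
`x_i → 0` with `τ^a(x) = Σ_i a^i·x_i`. -/
theorem stmt2 {p : ℕ} [Fact p.Prime]
    (W : Type*) [NormedAddCommGroup W] [NormedSpace ℚ_[p] W] [CompleteSpace W]
    (hna : ∀ x y : W, ‖x + y‖ ≤ max ‖x‖ ‖y‖)
    (ρ : ℤ_[p] → Module.End ℚ_[p] W)
    (hρ0 : ρ 0 = 1)
    (hρadd : ∀ a b : ℤ_[p], ρ (a + b) = ρ a * ρ b)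
    (hρiso : ∀ (a : ℤ_[p]) (w : W), ‖ρ a w‖ = ‖w‖)
    (hρcont : Continuous fun q : ℤ_[p] × W => ρ q.1 q.2)
    (x : W) (r R : ℝ) (k₀ : ℕ)
    (hr0 : 0 < r)
    (hr1 : r < min (1 / Real.exp 1) ((p : ℝ) ^ (-(1 / ((p : ℝ) - 1)))))
    (hR : 0 < R)
    (hbd1 : ∀ (a : ℤ_[p]) (k : ℕ), k < k₀ → ‖((1 - ρ a) ^ k) x‖ ≤ R)
    (hbd2 : ∀ (a : ℤ_[p]) (k : ℕ), k₀ ≤ k → ‖((1 - ρ a) ^ k) x‖ ≤ r ^ k) :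
    ∃ L : ℕ → W, L 0 = x ∧
      (∀ i : ℕ, HasSum
        (fun k : ℕ => -((((k : ℚ_[p]) + 1))⁻¹ • (((1 - ρ 1) ^ (k + 1)) (L i))))
        (L (i + 1))) ∧
      Tendsto (fun i : ℕ => ‖((i.factorial : ℚ_[p]))⁻¹ • L i‖) atTop (nhds 0) ∧
      (∀ a : ℤ_[p], HasSum
        (fun i : ℕ => (((a : ℚ_[p]) ^ i) * ((i.factorial : ℚ_[p]))⁻¹) • L i) (ρ a x)) ∧
      ∃ xs : ℕ → W, Tendsto xs atTop (nhds 0) ∧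
        ∀ a : ℤ_[p], HasSum (fun i : ℕ => ((a : ℚ_[p]) ^ i) • xs i) (ρ a x) := by
  have hT : Continuous (1 - ρ 1 : Module.End ℚ_[p] W) :=
    continuous_id.sub (hρcont.comp (Continuous.prodMk_right 1))
  obtain ⟨s, hs0, hs1, hs⟩ :=
    exists_norm_signedChooseCoeff_mul_pow_le hr0 (hr1.trans_le (min_le_right _ _))
  obtain ⟨C, hx⟩ : ∃ C, ∀ k, ‖((1 - ρ 1) ^ k) x‖ ≤ C * r ^ k := by
    refine ⟨1 + ∑ k ∈ Finset.range k₀, R / r ^ k, fun k => ?_⟩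
    have hnn : ∀ k ∈ Finset.range k₀, 0 ≤ R / r ^ k := fun k _ => by positivity
    rcases lt_or_ge k k₀ with hk | hk
    · have h := Finset.single_le_sum hnn (Finset.mem_range.mpr hk)
      exact (hbd1 1 k hk).trans ((div_le_iff₀ (by positivity)).mp (by linarith))
    · exact (hbd2 1 k hk).trans (le_mul_of_one_le_left (by positivity)
        (by linarith [Finset.sum_nonneg hnn]))
  set D : W → W := fun w => mahlerCoeff (1 - ρ 1) w 1
  have hL : ∀ i, ∃ C, ∀ k, ‖((1 - ρ 1) ^ k) (D^[i] x)‖ ≤ C * r ^ k := fun i => by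
    induction i with
    | zero => exact ⟨C, hx⟩
    | succ i ih =>
      obtain ⟨C', hC'⟩ := ih
      refine ⟨(1 - s)⁻¹ * C' * s, fun k => ?_⟩
      rw [Function.iterate_succ_apply']
      exact (norm_pow_mahlerCoeff_le hT hr0 hs0 hs1 hs hC' k 1).trans_eq (by ring)
  have hcoeff := mahlerCoeff_eq_iterate hρ0 hρadd hρiso hρcont hr0 hs0 hs1 hs hx
  have htend : Tendsto (mahlerCoeff (1 - ρ 1) x) atTop (nhds 0) :=
    (summable_norm_mahlerCoeff hT hr0 hs0 hs1 hs hx).of_norm.tendsto_atTop_zero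
  have hsum := hasSum_padicInt_pow_smul_mahlerCoeff hρ0 hρadd hρcont hr0 hs0 hs1 hs hx
  refine ⟨fun i => D^[i] x, rfl, fun i => ?_, ?_, fun a => ?_, _, htend, hsum⟩
  · obtain ⟨C', hC'⟩ := hL i
    beta_reduce
    rw [Function.iterate_succ_apply']
    exact hasSum_log hr0 hs0 hs1 hs hC'
  · simpa only [hcoeff, norm_zero] using htend.norm
  · simpa only [hcoeff, smul_smul] using hsum a
end

section
/- Under the hypotheses of the context, for every a ∈ ℤ_p the series (log τ^a)(x) = −Σ_{k≥1} (1−τ^a)^k(x)/k converges in W; for all α, β ∈ ℤ_p one has (log τ^{α+β})(x) = (log τ^α)(x) + (log τ^β)(x); and consequently (log τ^a)(x) = a·(log τ)(x) for every a ∈ ℤ_p. -/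
open Filter

open Topology

theorem Padic.norm_inv_natCast_add_one_le {p : ℕ} [Fact p.Prime] (k : ℕ) :
    ‖((k : ℚ_[p]) + 1)⁻¹‖ ≤ (k : ℝ) + 1 := by
  have h0 : ((k + 1 : ℕ) : ℚ_[p]) ≠ 0 := by exact_mod_cast k.succ_ne_zero
  have h : p ^ padicValNat p (k + 1) ≤ k + 1 :=
    Nat.le_of_dvd k.succ_pos pow_padicValNat_dvd
  have h2 := Padic.norm_eq_zpow_neg_valuation h0
  rw [Padic.valuation_natCast, zpow_neg, zpow_natCast] at h2
  push_cast at h2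
  rw [norm_inv, h2, inv_inv]
  exact_mod_cast h

theorem Padic.inv_mul_choose_succ {p : ℕ} [Fact p.Prime] {N : ℕ} (hN : N ≠ 0) (k : ℕ) :
    (N : ℚ_[p])⁻¹ * (N.choose (k + 1) : ℚ_[p]) =
      ((N - 1).choose k : ℚ_[p]) * ((k : ℚ_[p]) + 1)⁻¹ := by
  obtain ⟨M, rfl⟩ := Nat.exists_eq_succ_of_ne_zero hN
  have h := congrArg (Nat.cast : ℕ → ℚ_[p]) (Nat.add_one_mul_choose_eq M k)
  have h1 : (M : ℚ_[p]) + 1 ≠ 0 := by exact_mod_cast M.succ_ne_zero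
  have h2 : (k : ℚ_[p]) + 1 ≠ 0 := by exact_mod_cast k.succ_ne_zero
  push_cast at h
  simp only [Nat.succ_eq_add_one, Nat.add_sub_cancel]
  push_cast
  field_simp
  linear_combination -h

theorem Padic.norm_natCast_le_one {p : ℕ} [Fact p.Prime] (n : ℕ) : ‖(n : ℚ_[p])‖ ≤ 1 := by
  simpa using Padic.norm_int_le_one (p := p) n

theorem Padic.tendsto_natCast_pow_zero {p : ℕ} [Fact p.Prime] :
    Tendsto (fun n : ℕ => (p : ℚ_[p]) ^ n) atTop (𝓝 0) :=
  tendsto_pow_atTop_nhds_zero_of_norm_lt_one Padic.norm_p_lt_one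

theorem Padic.tendsto_choose_prime_pow_sub_one {p : ℕ} [Fact p.Prime] (k : ℕ) :
    Tendsto (fun n : ℕ => ((p ^ n - 1).choose k : ℚ_[p])) atTop (𝓝 ((-1) ^ k)) := by
  have hp : p ≠ 0 := (Fact.out : p.Prime).ne_zero
  induction k with
  | zero => simp
  | succ k ih =>
    have h0 : Tendsto (fun n : ℕ => ((p ^ n).choose (k + 1) : ℚ_[p])) atTop (𝓝 0) := by
      have := (Padic.tendsto_natCast_pow_zero (p := p)).mul (ih.mul_const ((k : ℚ_[p]) + 1)⁻¹)
      rw [zero_mul] at this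
      refine this.congr fun n => ?_
      have hN : p ^ n ≠ 0 := pow_ne_zero n hp
      have hN' : (p : ℚ_[p]) ^ n ≠ 0 := by exact_mod_cast hN
      rw [← Padic.inv_mul_choose_succ hN, Nat.cast_pow, mul_inv_cancel_left₀ hN']
    have := h0.sub ih
    rw [zero_sub, ← neg_one_mul, ← pow_succ'] at this
    refine this.congr fun n => ?_
    obtain ⟨M, hM⟩ := Nat.exists_eq_succ_of_ne_zero (pow_ne_zero n hp)
    rw [hM, Nat.succ_eq_add_one, Nat.add_sub_cancel, Nat.choose_succ_succ']
    push_cast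
    ring

section LogSeries

variable {p : ℕ} [Fact p.Prime] {W : Type*} [NormedAddCommGroup W] [NormedSpace ℚ_[p] W]

theorem Module.End.pow_apply_sub_self_eq_sum (T : Module.End ℚ_[p] W) (N : ℕ) (x : W) :
    (T ^ N) x - x = ∑ k ∈ Finset.range N,
      ((-1) ^ (k + 1) * (N.choose (k + 1) : ℚ_[p])) • ((1 - T) ^ (k + 1)) x := by
  have h : T ^ N = ∑ k ∈ Finset.range (N + 1),
      ((-1) ^ k * (N.choose k : ℚ_[p])) • (1 - T) ^ k := by
    conv_lhs => rw [show T = -(1 - T) + 1 by abel, (Commute.one_right _).add_pow]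
    refine Finset.sum_congr rfl fun k _ => ?_
    rw [one_pow, mul_one, neg_pow, ← Nat.cast_commute, ← nsmul_eq_mul, mul_smul,
      ← Nat.cast_smul_eq_nsmul ℚ_[p], smul_comm]
    rcases Nat.even_or_odd k with h' | h' <;> simp [h'.neg_one_pow]
  rw [h, Finset.sum_range_succ', LinearMap.add_apply, LinearMap.sum_apply]
  simp

theorem norm_inv_smul_pow_succ_le (T : Module.End ℚ_[p] W) (x : W) {C r : ℝ}
    (hb : ∀ k, ‖((1 - T) ^ k) x‖ ≤ C * r ^ k) (k : ℕ) :
    ‖((k : ℚ_[p]) + 1)⁻¹ • ((1 - T) ^ (k + 1)) x‖ ≤ C * (((k + 1 : ℕ) : ℝ) ^ 1 * r ^ (k + 1)) := by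
  rw [norm_smul]
  refine (mul_le_mul (Padic.norm_inv_natCast_add_one_le k) (hb (k + 1)) (norm_nonneg _)
    (by positivity)).trans_eq ?_
  push_cast
  ring

theorem summable_mul_natCast_succ_mul_geometric (C : ℝ) {r : ℝ} (hr : 0 ≤ r) (hr1 : r < 1) :
    Summable fun k : ℕ => C * (((k + 1 : ℕ) : ℝ) ^ 1 * r ^ (k + 1)) := by
  have h := summable_pow_mul_geometric_of_norm_lt_one 1
    (show ‖r‖ < 1 by rwa [Real.norm_of_nonneg hr])
  exact ((summable_nat_add_iff 1).2 h).mul_left C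

theorem tendsto_inv_smul_pow_prime_pow_sub [CompleteSpace W] (T : Module.End ℚ_[p] W) (x : W)
    {C r : ℝ} (hr : 0 ≤ r) (hr1 : r < 1) (hb : ∀ k, ‖((1 - T) ^ k) x‖ ≤ C * r ^ k) :
    Tendsto (fun n : ℕ => ((p : ℚ_[p]) ^ n)⁻¹ • ((T ^ p ^ n) x - x)) atTop
      (𝓝 (∑' k : ℕ, -(((k : ℚ_[p]) + 1)⁻¹ • ((1 - T) ^ (k + 1)) x))) := by
  have hp : p ≠ 0 := (Fact.out : p.Prime).ne_zero
  have key (n : ℕ) : ((p : ℚ_[p]) ^ n)⁻¹ • ((T ^ p ^ n) x - x) =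
      ∑' k : ℕ, ((-1) ^ (k + 1) * ((p ^ n - 1).choose k : ℚ_[p])) •
        ((k : ℚ_[p]) + 1)⁻¹ • ((1 - T) ^ (k + 1)) x := by
    have hN : p ^ n ≠ 0 := pow_ne_zero n hp
    rw [Module.End.pow_apply_sub_self_eq_sum, Finset.smul_sum, tsum_eq_sum (s := .range (p ^ n))]
    · refine Finset.sum_congr rfl fun k _ => ?_
      rw [smul_smul, smul_smul, mul_left_comm, ← Nat.cast_pow, Padic.inv_mul_choose_succ hN,
        mul_assoc]
    · intro k hk
      rw [Finset.mem_range, not_lt] at hk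
      rw [Nat.choose_eq_zero_of_lt (by lia)]
      simp
  simp_rw [key]
  refine tendsto_tsum_of_dominated_convergence
    (summable_mul_natCast_succ_mul_geometric C hr hr1) (fun k => ?_) (.of_forall fun n k => ?_)
  · have h := ((Padic.tendsto_choose_prime_pow_sub_one (p := p) k).const_mul
      ((-1) ^ (k + 1))).smul_const (((k : ℚ_[p]) + 1)⁻¹ • ((1 - T) ^ (k + 1)) x)
    have hs : ((-1) ^ (k + 1) * (-1) ^ k : ℚ_[p]) = -1 := by
      rw [pow_succ, mul_right_comm, ← mul_pow]
      norm_num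
    rwa [hs, neg_one_smul] at h
  · refine le_trans ?_ (norm_inv_smul_pow_succ_le T x hb k)
    rw [norm_smul]
    refine mul_le_of_le_one_left (norm_nonneg _) ?_
    simpa using Padic.norm_natCast_le_one (p := p) ((p ^ n - 1).choose k)

end LogSeries

/-- Under the hypotheses of the `ℤ_p`-analyticity criterion: for every `a ∈ ℤ_p` the
series `(log τ^a)(x) = −Σ_{k≥1}(1−τ^a)^k(x)/k` converges, the resulting function is
additive in `a`, and consequently `(log τ^a)(x) = a·(log τ)(x)` for every `a ∈ ℤ_p`. -/
theorem stmt3 {p : ℕ} [Fact p.Prime]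
    (W : Type*) [NormedAddCommGroup W] [NormedSpace ℚ_[p] W] [CompleteSpace W]
    (hna : ∀ x y : W, ‖x + y‖ ≤ max ‖x‖ ‖y‖)
    (ρ : ℤ_[p] → Module.End ℚ_[p] W)
    (hρ0 : ρ 0 = 1)
    (hρadd : ∀ a b : ℤ_[p], ρ (a + b) = ρ a * ρ b)
    (hρiso : ∀ (a : ℤ_[p]) (w : W), ‖ρ a w‖ = ‖w‖)
    (hρcont : Continuous fun q : ℤ_[p] × W => ρ q.1 q.2)
    (x : W) (r R : ℝ) (k₀ : ℕ)
    (hr0 : 0 < r)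
    (hr1 : r < min (1 / Real.exp 1) ((p : ℝ) ^ (-(1 / ((p : ℝ) - 1)))))
    (hR : 0 < R)
    (hbd1 : ∀ (a : ℤ_[p]) (k : ℕ), k < k₀ → ‖((1 - ρ a) ^ k) x‖ ≤ R)
    (hbd2 : ∀ (a : ℤ_[p]) (k : ℕ), k₀ ≤ k → ‖((1 - ρ a) ^ k) x‖ ≤ r ^ k) :
    ∃ Lg : ℤ_[p] → W,
      (∀ a : ℤ_[p], HasSum
        (fun k : ℕ => -((((k : ℚ_[p]) + 1))⁻¹ • (((1 - ρ a) ^ (k + 1)) x))) (Lg a)) ∧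
      (∀ α β : ℤ_[p], Lg (α + β) = Lg α + Lg β) ∧
      ∀ a : ℤ_[p], Lg a = (a : ℚ_[p]) • Lg 1 := by
  have hr : r < 1 := hr1.trans_le <| (min_le_left _ _).trans <| by
    rw [div_le_one (Real.exp_pos 1)]
    exact Real.one_le_exp zero_le_one
  have hb (a : ℤ_[p]) (k : ℕ) : ‖((1 - ρ a) ^ k) x‖ ≤ (1 + R / r ^ k₀) * r ^ k := by
    have hk : 0 < r ^ k := pow_pos hr0 k
    have hk₀ : 0 < r ^ k₀ := pow_pos hr0 k₀
    rcases lt_or_ge k k₀ with h | h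
    · have h1 : r ^ k₀ ≤ r ^ k := pow_le_pow_of_le_one hr0.le hr.le h.le
      have h2 : R ≤ R / r ^ k₀ * r ^ k := by
        rw [div_mul_eq_mul_div, le_div_iff₀ hk₀]
        gcongr
      linarith [hbd1 a k h]
    · have h2 : 0 ≤ R / r ^ k₀ * r ^ k := by positivity
      linarith [hbd2 a k h]
  have hu := summable_mul_natCast_succ_mul_geometric (1 + R / r ^ k₀) hr0.le hr
  have hterm (a : ℤ_[p]) (k : ℕ) :
      ‖-(((k : ℚ_[p]) + 1)⁻¹ • ((1 - ρ a) ^ (k + 1)) x)‖ ≤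
        (1 + R / r ^ k₀) * (((k + 1 : ℕ) : ℝ) ^ 1 * r ^ (k + 1)) := by
    rw [norm_neg]
    exact norm_inv_smul_pow_succ_le (ρ a) x (hb a) k
  have hcont (k : ℕ) : Continuous fun a : ℤ_[p] => ((1 - ρ a) ^ k) x := by
    induction k with
    | zero => simpa using continuous_const
    | succ k ih =>
      simp only [pow_succ', Module.End.mul_apply, LinearMap.sub_apply, Module.End.one_apply]
      exact ih.sub (hρcont.comp (continuous_id.prodMk ih))
  have hρnat (n : ℕ) (a : ℤ_[p]) : ρ (n * a) = ρ a ^ n := by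
    induction n with
    | zero => simpa using hρ0
    | succ n ih => rw [Nat.cast_succ, add_one_mul, hρadd, ih, pow_succ]
  let L : ℤ_[p] → W := fun a => ∑' k : ℕ, -(((k : ℚ_[p]) + 1)⁻¹ • ((1 - ρ a) ^ (k + 1)) x)
  have hLcont : Continuous L :=
    continuous_tsum (fun k => ((hcont (k + 1)).const_smul _).neg) hu fun k a => hterm a k
  have hlim (a : ℤ_[p]) : Tendsto
      (fun n : ℕ => ((p : ℚ_[p]) ^ n)⁻¹ • (ρ ((p ^ n : ℕ) * a) x - x)) atTop (𝓝 (L a)) := by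
    simp_rw [hρnat]
    exact tendsto_inv_smul_pow_prime_pow_sub (ρ a) x hr0.le hr (hb a)
  have hadd (a b : ℤ_[p]) : L (a + b) = L a + L b := by
    refine tendsto_nhds_unique (hlim (a + b)) ?_
    have h0 : Tendsto (fun n : ℕ => ((p ^ n : ℕ) : ℤ_[p]) * a) atTop (𝓝 0) := by
      simpa using (tendsto_pow_atTop_nhds_zero_of_norm_lt_one
        ((PadicInt.norm_lt_one_iff_dvd (p : ℤ_[p])).2 dvd_rfl)).mul_const a
    have h1 := (hρcont.tendsto (0, L b)).comp (h0.prodMk_nhds (hlim b))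
    rw [hρ0, Module.End.one_apply] at h1
    have h2 := (hlim a).add h1
    refine h2.congr fun n => ?_
    simp only [Function.comp_apply]
    rw [map_smul, ← smul_add, map_sub, mul_add, hρadd, Module.End.mul_apply]
    congr 1
    abel
  have hnat (n : ℕ) : L n = ((n : ℤ_[p]) : ℚ_[p]) • L 1 := by
    induction n with
    | zero => simpa using hadd 0 0
    | succ n ih =>
      rw [Nat.cast_succ, hadd, ih, PadicInt.coe_add, PadicInt.coe_one, add_smul, one_smul]
  refine ⟨L, fun a => (Summable.of_norm_bounded hu (hterm a)).hasSum, hadd, ?_⟩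
  exact congrFun <| PadicInt.denseRange_natCast.equalizer hLcont
    (continuous_subtype_val.smul continuous_const) (funext hnat)
end

section
/- Under the hypotheses of the context, for every a ∈ ℤ_p, every integer k with k ≥ 1 and k ≥ k₀, every integer n ≥ k, and all positive integers i₁, …, i_k with i₁ + ⋯ + i_k = n, one has ‖(1/(k!·i₁⋯i_k))·(1−τ^a)^n(x)‖ ≤ (r·p^{1/(p−1)})^k, where the rational number 1/(k!·i₁⋯i_k) is viewed as a scalar in ℚ_p. (These are exactly the general terms of the double series defining exp((log τ^a))(x), so this bound gives its absolute convergence, since r·p^{1/(p−1)} < 1.) -/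
/-- The inverse `p`-adic norm of a nonzero natural number is `p` to its valuation. -/
lemma inv_norm_padic_natCast {p : ℕ} [Fact p.Prime] {m : ℕ} (hm : m ≠ 0) :
    ‖(m : ℚ_[p])‖⁻¹ = (p : ℝ) ^ padicValNat p m := by
  rw [Padic.norm_eq_zpow_neg_valuation (Nat.cast_ne_zero.mpr hm), Padic.valuation_natCast,
    zpow_neg, inv_inv, zpow_natCast]

lemma inv_norm_padic_natCast_le {p : ℕ} [Fact p.Prime] {m : ℕ} (hm : m ≠ 0) :
    ‖(m : ℚ_[p])‖⁻¹ ≤ m := by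
  rw [inv_norm_padic_natCast hm]
  exact_mod_cast Nat.le_of_dvd (Nat.pos_of_ne_zero hm) pow_padicValNat_dvd

lemma inv_norm_padic_factorial_le {p : ℕ} [hp : Fact p.Prime] (k : ℕ) :
    ‖(k.factorial : ℚ_[p])‖⁻¹ ≤ ((p : ℝ) ^ ((1 : ℝ) / ((p : ℝ) - 1))) ^ k := by
  have hp1 : (1 : ℝ) < p := by exact_mod_cast hp.out.one_lt
  have hval : (p - 1) * padicValNat p k.factorial ≤ k := by
    rw [sub_one_mul_padicValNat_factorial]
    exact Nat.sub_le _ _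
  have hval' : ((p : ℝ) - 1) * padicValNat p k.factorial ≤ k := by
    have h : (((p - 1) * padicValNat p k.factorial : ℕ) : ℝ) ≤ k := by exact_mod_cast hval
    rwa [Nat.cast_mul, Nat.cast_sub hp.out.one_le, Nat.cast_one] at h
  rw [inv_norm_padic_natCast k.factorial_ne_zero, ← Real.rpow_natCast, ← Real.rpow_natCast,
    ← Real.rpow_mul (by positivity)]
  refine Real.rpow_le_rpow_of_exponent_le hp1.le ?_
  rw [one_div_mul_eq_div, le_div_iff₀ (by linarith)]
  linarith

/-- If `0 ≤ r ≤ 1 / e`, then `m * r ^ m ≤ r` for every positive integer `m`. -/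
lemma natCast_mul_pow_le_self {r : ℝ} (hr0 : 0 ≤ r) (hr : r ≤ 1 / Real.exp 1) {m : ℕ}
    (hm : 1 ≤ m) : (m : ℝ) * r ^ m ≤ r := by
  obtain ⟨l, rfl⟩ := Nat.exists_eq_add_of_le' hm
  have hre : r * Real.exp 1 ≤ 1 := (le_div_iff₀ (Real.exp_pos 1)).mp hr
  have hexp : ((l + 1 : ℕ) : ℝ) ≤ Real.exp 1 ^ l := by
    rw [← Real.exp_nat_mul, mul_one]
    exact_mod_cast Real.add_one_le_exp (l : ℝ)
  calc ((l + 1 : ℕ) : ℝ) * r ^ (l + 1) ≤ Real.exp 1 ^ l * r ^ (l + 1) := by gcongr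
    _ = (r * Real.exp 1) ^ l * r := by ring
    _ ≤ 1 * r := by gcongr; exact pow_le_one₀ (by positivity) hre
    _ = r := one_mul r

/-- Bound on the general terms of the double series defining `exp(log τ^a)(x)`: under the
hypotheses of the `ℤ_p`-analyticity criterion, for `k ≥ 1` with `k ≥ k₀`, `n ≥ k` and
positive integers `i₁, …, i_k` summing to `n`,
`‖(1/(k!·i₁⋯i_k))·(1−τ^a)^n(x)‖ ≤ (r·p^{1/(p−1)})^k`. -/
theorem stmt4 {p : ℕ} [Fact p.Prime]
    (W : Type*) [NormedAddCommGroup W] [NormedSpace ℚ_[p] W] [CompleteSpace W]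
    (hna : ∀ x y : W, ‖x + y‖ ≤ max ‖x‖ ‖y‖)
    (ρ : ℤ_[p] → Module.End ℚ_[p] W)
    (hρ0 : ρ 0 = 1)
    (hρadd : ∀ a b : ℤ_[p], ρ (a + b) = ρ a * ρ b)
    (hρiso : ∀ (a : ℤ_[p]) (w : W), ‖ρ a w‖ = ‖w‖)
    (hρcont : Continuous fun q : ℤ_[p] × W => ρ q.1 q.2)
    (x : W) (r R : ℝ) (k₀ : ℕ)
    (hr0 : 0 < r)
    (hr1 : r < min (1 / Real.exp 1) ((p : ℝ) ^ (-(1 / ((p : ℝ) - 1)))))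
    (hR : 0 < R)
    (hbd1 : ∀ (a : ℤ_[p]) (k : ℕ), k < k₀ → ‖((1 - ρ a) ^ k) x‖ ≤ R)
    (hbd2 : ∀ (a : ℤ_[p]) (k : ℕ), k₀ ≤ k → ‖((1 - ρ a) ^ k) x‖ ≤ r ^ k)
    (a : ℤ_[p]) (k n : ℕ) (hk1 : 1 ≤ k) (hkk₀ : k₀ ≤ k) (hkn : k ≤ n)
    (i : Fin k → ℕ) (hi : ∀ j, 1 ≤ i j) (hisum : ∑ j, i j = n) :
    ‖((((k.factorial : ℚ_[p]) * ∏ j, (i j : ℚ_[p]))))⁻¹ • (((1 - ρ a) ^ n) x)‖ ≤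
      (r * (p : ℝ) ^ ((1 : ℝ) / ((p : ℝ) - 1))) ^ k := by
  have hre : r ≤ 1 / Real.exp 1 := (hr1.trans_le (min_le_left _ _)).le
  have hprod : (∏ j, ‖(i j : ℚ_[p])‖⁻¹) * r ^ n ≤ r ^ k := by
    rw [← hisum, ← Finset.prod_pow_eq_pow_sum, ← Finset.prod_mul_distrib]
    calc ∏ j, ‖(i j : ℚ_[p])‖⁻¹ * r ^ i j ≤ ∏ _j : Fin k, r := by
          refine Finset.prod_le_prod (fun j _ => by positivity) fun j _ => ?_
          refine le_trans ?_ (natCast_mul_pow_le_self hr0.le hre (hi j))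
          gcongr
          exact inv_norm_padic_natCast_le (Nat.one_le_iff_ne_zero.mp (hi j))
      _ = r ^ k := by simp
  rw [norm_smul, norm_inv, norm_mul, norm_prod, mul_inv, ← Finset.prod_inv_distrib, mul_assoc,
    mul_pow, mul_comm (r ^ k)]
  refine mul_le_mul (inv_norm_padic_factorial_le k) (le_trans ?_ hprod) (by positivity)
    (by positivity)
  gcongr
  exact hbd2 a n (hkk₀.trans hkn)
end

section
/- For every integer m ≥ 1 and every prime p, there exist polynomials f_1, …, f_{p^m−1} ∈ ℤ[X], depending only on p, m and the index j, such that for every ℚ_p-algebra A and all elements a, b ∈ A with ab = ba, one has log_m(ab) − log_m(a) − log_m(b) = Σ_{j=1}^{p^m−1} f_j(1−a)·(1−a)^{p^m−j}·(1−b)^j/j. -/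
/-- The partial logarithm `log_m(a) := Σ_{i=1}^{p^m − 1} (1 − a)^i / i`, a finite sum in a
(possibly noncommutative) `ℚ_p`-algebra `A`. -/
noncomputable def partialLog (p m : ℕ) [Fact p.Prime] {A : Type*} [Ring A]
    [Algebra ℚ_[p] A] (a : A) : A :=
  ∑ i ∈ Finset.Icc 1 (p ^ m - 1), ((i : ℚ_[p]))⁻¹ • (1 - a) ^ i

open Polynomial in
/-- The truncated series of `((1 - X)⁻¹) ^ (d + 2)`, multiplied by `1 - X`. -/
theorem one_sub_X_mul_sum_choose (d n : ℕ) :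
    (1 - X : ℤ[X]) * ∑ k ∈ Finset.range n, ((k + (d + 1)).choose (d + 1) : ℤ[X]) * X ^ k =
      ∑ k ∈ Finset.range n, ((k + d).choose d : ℤ[X]) * X ^ k -
        ((n + d).choose (d + 1) : ℤ[X]) * X ^ n := by
  induction n with
  | zero => simp
  | succ n ih =>
    have h : (n + (d + 1)).choose (d + 1) = (n + d).choose d + (n + d).choose (d + 1) :=
      Nat.choose_succ_succ _ _
    have h' : n + 1 + d = n + (d + 1) := by ring
    rw [Finset.sum_range_succ, mul_add, ih, Finset.sum_range_succ, h', h]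
    push_cast
    ring

open Polynomial in
/-- The truncated binomial series inverts `(1 - X) ^ (d + 1)` modulo `X ^ n`. -/
theorem X_pow_dvd_one_sub_X_pow_mul_sum_choose_sub_one (d n : ℕ) :
    (X : ℤ[X]) ^ n ∣ (1 - X) ^ (d + 1) *
      ∑ k ∈ Finset.range n, ((k + d).choose d : ℤ[X]) * X ^ k - 1 := by
  induction d with
  | zero =>
    refine ⟨-1, ?_⟩
    have h := mul_neg_geom_sum (X : ℤ[X]) n
    simp only [zero_add, pow_one, add_zero, Nat.choose_zero_right, Nat.cast_one, one_mul]
    rw [h]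
    ring
  | succ d ih =>
    obtain ⟨g, hg⟩ := ih
    refine ⟨g - (1 - X) ^ (d + 1) * ((n + d).choose (d + 1) : ℤ[X]), ?_⟩
    rw [pow_succ, mul_assoc, one_sub_X_mul_sum_choose, mul_sub, mul_sub, ← hg]
    ring

/-- Reindexing a sum over `1, …, N` from zero. -/
theorem sum_Icc_one_eq_sum_range {M : Type*} [AddCommMonoid M] (g : ℕ → M) (N : ℕ) :
    ∑ i ∈ Finset.Icc 1 N, g i = ∑ i ∈ Finset.range N, g (i + 1) := by
  rw [Finset.range_eq_Ico, Finset.sum_Ico_add' g 0 N 1]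
  rfl

theorem inv_mul_choose_succ {K : Type*} [Field K] [CharZero K] (j k : ℕ) :
    ((j + k + 1 : ℕ) : K)⁻¹ * ((j + k + 1).choose (j + 1) : K) =
      ((j + 1 : ℕ) : K)⁻¹ * ((k + j).choose j : K) := by
  have h := Nat.add_one_mul_choose_eq (j + k) j
  have h1 : ((j + k + 1 : ℕ) : K) ≠ 0 := Nat.cast_ne_zero.2 (by omega)
  have h2 : ((j + 1 : ℕ) : K) ≠ 0 := Nat.cast_ne_zero.2 (by omega)
  have h' : ((j + k + 1 : ℕ) : K) * ((j + k).choose j : K) =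
      ((j + k + 1).choose (j + 1) : K) * ((j + 1 : ℕ) : K) := by exact_mod_cast h
  rw [add_comm k j, inv_mul_eq_iff_eq_mul₀ h1, mul_left_comm, h', mul_comm, mul_assoc,
    mul_inv_cancel₀ h2, mul_one]

/-- The truncated logarithm series at `x + (1 - x) y`, expanded in powers of `y`. -/
theorem sum_inv_smul_add_pow {K A : Type*} [Field K] [CharZero K] [Ring A] [Algebra K A]
    {x y : A} (hxy : Commute x y) (N : ℕ) :
    ∑ i ∈ Finset.range N, ((i + 1 : ℕ) : K)⁻¹ • ((1 - x) * y + x) ^ (i + 1) =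
      ∑ i ∈ Finset.range N, ((i + 1 : ℕ) : K)⁻¹ • x ^ (i + 1) +
      ∑ j ∈ Finset.range N, ((j + 1 : ℕ) : K)⁻¹ •
        (((1 - x) ^ (j + 1) * ∑ k ∈ Finset.range (N - j), ((k + j).choose j : A) * x ^ k) *
          y ^ (j + 1)) := by
  have hx1 : Commute (1 - x) y := (Commute.one_left y).sub_left hxy
  have hz : Commute ((1 - x) * y) x :=
    ((Commute.one_left x).sub_left (Commute.refl x)).mul_left hxy.symm
  have hexp (i : ℕ) : ((i + 1 : ℕ) : K)⁻¹ • ((1 - x) * y + x) ^ (i + 1) =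
      ((i + 1 : ℕ) : K)⁻¹ • x ^ (i + 1) +
      ∑ j ∈ Finset.range (i + 1), ((i + 1 : ℕ) : K)⁻¹ •
        (((1 - x) * y) ^ (j + 1) * x ^ (i - j) * ((i + 1).choose (j + 1) : A)) := by
    rw [hz.add_pow, Finset.sum_range_succ', smul_add, add_comm, Finset.smul_sum]
    simp
  rw [Finset.sum_congr rfl fun i _ ↦ hexp i, Finset.sum_add_distrib]
  congr 1
  rw [Finset.sum_comm' (t' := Finset.range N) (s' := fun j ↦ Finset.Ico j N)
    (by intro i j; simp only [Finset.mem_range, Finset.mem_Ico]; omega)]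
  refine Finset.sum_congr rfl fun j _ ↦ ?_
  rw [Finset.sum_Ico_eq_sum_range, Finset.mul_sum, Finset.sum_mul, Finset.smul_sum]
  refine Finset.sum_congr rfl fun k _ ↦ ?_
  have hc (c : ℕ) (z : A) : z * (c : A) = (c : K) • z := by
    rw [Nat.cast_smul_eq_nsmul, nsmul_eq_mul, Nat.cast_comm]
  rw [hc, smul_smul, inv_mul_choose_succ, Nat.add_sub_cancel_left, hx1.mul_pow, ← smul_smul,
    Nat.cast_comm _ (x ^ k), hc, mul_smul_comm, smul_mul_assoc, mul_assoc, mul_assoc,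
    (hxy.pow_pow k (j + 1)).eq]

/-- For every `m ≥ 1` and prime `p`, there exist polynomials `f_1, …, f_{p^m−1} ∈ ℤ[X]`
such that for every `ℚ_p`-algebra `A` and all commuting `a, b ∈ A`,
`log_m(ab) − log_m(a) − log_m(b) = Σ_{j=1}^{p^m−1} f_j(1−a)·(1−a)^{p^m−j}·(1−b)^j / j`. -/
theorem stmt5 (p m : ℕ) [Fact p.Prime] (hm : 1 ≤ m) :
    ∃ f : ℕ → Polynomial ℤ,
      ∀ (A : Type*) [Ring A] [Algebra ℚ_[p] A] (a b : A), a * b = b * a →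
        partialLog p m (a * b) - partialLog p m a - partialLog p m b =
          ∑ j ∈ Finset.Icc 1 (p ^ m - 1),
            ((j : ℚ_[p]))⁻¹ •
              (Polynomial.aeval (1 - a) (f j) * (1 - a) ^ (p ^ m - j) * (1 - b) ^ j) := by
  choose g hg using X_pow_dvd_one_sub_X_pow_mul_sum_choose_sub_one
  refine ⟨fun j ↦ g (j - 1) (p ^ m - j), fun A _ _ a b hab ↦ ?_⟩
  have hxy : Commute (1 - a) (1 - b) :=
    (Commute.one_left _).sub_left ((Commute.one_right a).sub_right hab)
  have hprod : 1 - a * b = (1 - (1 - a)) * (1 - b) + (1 - a) := by noncomm_ring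
  simp only [partialLog, sum_Icc_one_eq_sum_range]
  rw [hprod, sum_inv_smul_add_pow hxy, add_sub_cancel_left, ← Finset.sum_sub_distrib]
  refine Finset.sum_congr rfl fun j _ ↦ ?_
  have h := congrArg (Polynomial.aeval (1 - a)) (hg j (p ^ m - (j + 1)))
  rw [mul_comm (_ ^ _) (g _ _)] at h
  simp only [map_sub, map_mul, map_pow, map_one, map_sum, map_natCast, Polynomial.aeval_X] at h
  rw [Nat.add_sub_cancel, ← h, ← smul_sub, sub_mul, one_mul,
    show p ^ m - 1 - j = p ^ m - (j + 1) by omega]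
end

section
/- Let h ≥ 1 be an integer and let v ∈ A satisfy ‖v‖ ≤ p^{−1/((p−1)p^{h−1})}. Then: (a) for every a ∈ ℤ_p the series F(a) := Σ_{m≥0} binom(a, m)·v^m converges in A; and (b) F is analytic on every closed disk of radius p^{−h} in ℤ_p: for every b ∈ ℤ_p there exists a sequence (w_j)_{j≥0} in A tending to 0 such that F(b + p^h·t) = Σ_{j≥0} w_j·t^j for every t ∈ ℤ_p. -/
open Filter

/-- The extended binomial coefficient `binom(a, m) = a(a−1)⋯(a−m+1)/m!` of `a ∈ ℤ_p`,
viewed in `ℚ_p` (its value in fact lies in `ℤ_p`). -/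
noncomputable def pbinom {p : ℕ} [Fact p.Prime] (a : ℤ_[p]) (m : ℕ) : ℚ_[p] :=
  ((m.factorial : ℚ_[p]))⁻¹ * ∏ i ∈ Finset.range m, ((a : ℚ_[p]) - (i : ℚ_[p]))

open Polynomial in
/-- The polynomial in `t` whose value at `t` is `binom(b + p ^ h * t, m)`. -/
noncomputable def pbinomPoly {p : ℕ} [Fact p.Prime] (b : ℤ_[p]) (h m : ℕ) : ℚ_[p][X] :=
  C ((m.factorial : ℚ_[p])⁻¹) *
    ∏ i ∈ Finset.range m, (C ((b : ℚ_[p]) - (i : ℚ_[p])) + C ((p : ℚ_[p]) ^ h) * X)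

section PadicBinomial

variable {p : ℕ} [Fact p.Prime]

theorem eval_pbinomPoly (b t : ℤ_[p]) (h m : ℕ) :
    (pbinomPoly b h m).eval (t : ℚ_[p]) = pbinom (b + (p : ℤ_[p]) ^ h * t) m := by
  simp only [pbinomPoly, pbinom, Polynomial.eval_mul, Polynomial.eval_C, Polynomial.eval_prod,
    Polynomial.eval_add, Polynomial.eval_X]
  congr 1
  refine Finset.prod_congr rfl fun i _ => ?_
  push_cast
  ring

theorem natDegree_pbinomPoly_le (b : ℤ_[p]) (h m : ℕ) : (pbinomPoly b h m).natDegree ≤ m := by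
  refine (Polynomial.natDegree_C_mul_le _ _).trans ((Polynomial.natDegree_prod_le _ _).trans ?_)
  refine (Finset.sum_le_card_nsmul _ _ 1 fun i _ => ?_).trans (by simp)
  compute_degree

open Polynomial in
theorem norm_coeff_prod_linear_le {ι : Type*} (s : Finset ι) (a : ι → ℚ_[p]) (c : ℚ_[p]) (j : ℕ) :
    ‖(∏ i ∈ s, (C (a i) + C c * X)).coeff j‖ ≤ ∏ i ∈ s, max ‖a i‖ ‖c‖ := by
  classical
  induction s using Finset.induction_on generalizing j with
  | empty =>
    simp only [Finset.prod_empty, coeff_one]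
    split_ifs <;> simp
  | insert i s hi ih =>
    rw [Finset.prod_insert hi, Finset.prod_insert hi, add_mul, mul_assoc, coeff_add, coeff_C_mul,
      coeff_C_mul]
    refine (IsUltrametricDist.norm_add_le_max _ _).trans (max_le ?_ ?_)
    · rw [norm_mul]
      gcongr
      · exact le_max_left _ _
      · exact ih j
    · rw [norm_mul]
      cases j with
      | zero => simpa using by positivity
      | succ j =>
        rw [coeff_X_mul]
        gcongr
        · exact le_max_right _ _
        · exact ih j

theorem max_norm_sub_natCast_le (b : ℤ_[p]) (h i : ℕ) :
    max ‖(b : ℚ_[p]) - (i : ℚ_[p])‖ ‖(p : ℚ_[p]) ^ h‖ ≤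
      (p : ℝ)⁻¹ ^ ((Finset.Icc 1 h).filter fun k => i ≡ b.appr h [MOD p ^ k]).card := by
  set S := (Finset.Icc 1 h).filter fun k => i ≡ b.appr h [MOD p ^ k] with hS
  have hp1 : (1 : ℝ) ≤ p := by exact_mod_cast (Fact.out : p.Prime).one_le
  have hcard : S.card ≤ h := (Finset.card_filter_le _ _).trans (by simp)
  refine max_le ?_ ?_
  · have hmod : i ≡ b.appr h [MOD p ^ S.card] := by
      rcases Nat.eq_zero_or_pos S.card with h0 | h0
      · simp [h0, Nat.modEq_one]
      · obtain ⟨k, hk, hle⟩ : ∃ k ∈ S, S.card ≤ k := by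
          by_contra! hcon
          have hsub : S ⊆ Finset.Icc 1 (S.card - 1) := fun k hk => by
            have h1 := hcon k hk
            have h2 := (Finset.mem_Icc.1 (Finset.mem_filter.1 hk).1).1
            exact Finset.mem_Icc.2 ⟨h2, by omega⟩
          have := Finset.card_le_card hsub
          simp at this
          omega
        exact (Finset.mem_filter.1 hk).2.of_dvd (pow_dvd_pow p hle)
    have hdvd : b - (i : ℤ_[p]) ∈ Ideal.span {(p : ℤ_[p]) ^ S.card} := by
      rw [Ideal.mem_span_singleton]
      have h1 : (p : ℤ_[p]) ^ S.card ∣ b - (b.appr h : ℤ_[p]) :=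
        (pow_dvd_pow _ hcard).trans (Ideal.mem_span_singleton.1 (PadicInt.appr_spec h b))
      have h2 : (p : ℤ_[p]) ^ S.card ∣ (b.appr h : ℤ_[p]) - (i : ℤ_[p]) := by
        have := map_dvd (Int.castRingHom ℤ_[p]) (Nat.modEq_iff_dvd.1 hmod)
        simpa using this
      simpa using dvd_add h1 h2
    have := (PadicInt.norm_le_pow_iff_mem_span_pow _ _).2 hdvd
    rw [zpow_neg, zpow_natCast, ← inv_pow, PadicInt.norm_def] at this
    simpa using this
  · rw [norm_pow, Padic.norm_p]
    exact pow_le_pow_of_le_one (by positivity) (inv_le_one_of_one_le₀ hp1) hcard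

theorem sum_div_pow_le_sum_card (B h m : ℕ) :
    ∑ k ∈ Finset.Icc 1 h, m / p ^ k ≤
      ∑ i ∈ Finset.range m, ((Finset.Icc 1 h).filter fun k => i ≡ B [MOD p ^ k]).card := by
  simp only [Finset.card_filter]
  rw [Finset.sum_comm]
  refine Finset.sum_le_sum fun k _ => ?_
  rw [← Finset.card_filter, ← Nat.count_eq_card_filter_range,
    Nat.count_modEq_card _ (pow_pos (Fact.out : p.Prime).pos k)]
  exact Nat.le_add_right _ _

theorem padicValNat_factorial_eq_add (h m : ℕ) :
    padicValNat p m.factorial =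
      (∑ k ∈ Finset.Icc 1 h, m / p ^ k) + padicValNat p (m / p ^ h).factorial := by
  set c := Nat.log p m + 1 with hc
  have h1 : Nat.log p m < h + c := by omega
  have h2 : Nat.log p (m / p ^ h) < c :=
    Nat.lt_succ_of_le (Nat.log_mono_right (Nat.div_le_self _ _))
  rw [padicValNat_factorial h1, padicValNat_factorial h2,
    ← Finset.sum_Ico_consecutive _ (show 1 ≤ h + 1 by omega) (show h + 1 ≤ h + c by omega)]
  congr 1
  rw [add_comm h 1, add_comm h c, ← Finset.sum_Ico_add]
  refine Finset.sum_congr rfl fun k _ => ?_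
  rw [Nat.div_div_eq_div_mul, pow_add]

theorem norm_natCast_factorial (m : ℕ) :
    ‖(m.factorial : ℚ_[p])‖ = (p : ℝ)⁻¹ ^ padicValNat p m.factorial := by
  rw [Padic.norm_eq_zpow_neg_valuation (by exact_mod_cast m.factorial_ne_zero),
    Padic.valuation_natCast, zpow_neg, zpow_natCast, inv_pow]

theorem norm_coeff_pbinomPoly_le (b : ℤ_[p]) (h m j : ℕ) :
    ‖(pbinomPoly b h m).coeff j‖ ≤ (p : ℝ) ^ padicValNat p (m / p ^ h).factorial := by
  have hp1 : (1 : ℝ) ≤ p := by exact_mod_cast (Fact.out : p.Prime).one_le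
  have hp0 : (0 : ℝ) < p := by linarith
  rw [pbinomPoly, Polynomial.coeff_C_mul, norm_mul, norm_inv, norm_natCast_factorial, inv_pow,
    inv_inv, padicValNat_factorial_eq_add h m, pow_add]
  have hprod := norm_coeff_prod_linear_le (Finset.range m)
    (fun i : ℕ => (b : ℚ_[p]) - (i : ℚ_[p])) ((p : ℚ_[p]) ^ h) j
  have hbound := hprod.trans (Finset.prod_le_prod (fun i _ => by positivity)
    fun i _ => max_norm_sub_natCast_le b h i)
  rw [Finset.prod_pow_eq_pow_sum] at hbound
  have hle := hbound.trans (pow_le_pow_of_le_one (by positivity) (inv_le_one_of_one_le₀ hp1)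
    (sum_div_pow_le_sum_card (p := p) (b.appr h) h m))
  calc _ ≤ (p : ℝ) ^ (∑ k ∈ Finset.Icc 1 h, m / p ^ k) *
        (p : ℝ) ^ padicValNat p (m / p ^ h).factorial *
        (p : ℝ)⁻¹ ^ (∑ k ∈ Finset.Icc 1 h, m / p ^ k) := by gcongr
    _ = _ := by
      rw [inv_pow]
      field_simp

theorem pow_padicValNat_factorial_mul_pow_le {h : ℕ} (hh : 1 ≤ h) {x : ℝ} (hx0 : 0 ≤ x)
    (hx : x ≤ (p : ℝ) ^ (-(1 / (((p : ℝ) - 1) * (p : ℝ) ^ (h - 1))))) (m : ℕ) :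
    (p : ℝ) ^ padicValNat p (m / p ^ h).factorial * x ^ m ≤
      ((p : ℝ) ^ (-(1 / (p : ℝ) ^ h))) ^ m := by
  have hp1 : (1 : ℝ) < p := by exact_mod_cast (Fact.out : p.Prime).one_lt
  have hp0 : (0 : ℝ) < p := by linarith
  have hp2 : (0 : ℝ) < (p : ℝ) - 1 := by linarith
  have hval : (padicValNat p (m / p ^ h).factorial : ℝ) ≤ m / (p : ℝ) ^ h / ((p : ℝ) - 1) := by
    have h1 : (p - 1) * padicValNat p (m / p ^ h).factorial ≤ m / p ^ h := by
      rw [sub_one_mul_padicValNat_factorial]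
      exact Nat.sub_le _ _
    have h2 : ((m / p ^ h : ℕ) : ℝ) ≤ m / (p : ℝ) ^ h := by
      simpa using Nat.cast_div_le (α := ℝ) (m := m) (n := p ^ h)
    rw [le_div_iff₀ hp2, mul_comm]
    refine le_trans ?_ h2
    have h3 : (((p - 1) * padicValNat p (m / p ^ h).factorial : ℕ) : ℝ) ≤ ((m / p ^ h : ℕ) : ℝ) :=
      by exact_mod_cast h1
    rwa [Nat.cast_mul, Nat.cast_sub (Fact.out : p.Prime).one_le, Nat.cast_one] at h3
  calc _ ≤ (p : ℝ) ^ ((m : ℝ) / (p : ℝ) ^ h / ((p : ℝ) - 1)) *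
        ((p : ℝ) ^ (-(1 / (((p : ℝ) - 1) * (p : ℝ) ^ (h - 1))))) ^ m := by
        rw [← Real.rpow_natCast (p : ℝ) (padicValNat p _)]
        gcongr
        exact hp1.le
    _ = _ := by
        rw [← Real.rpow_mul_natCast hp0.le, ← Real.rpow_mul_natCast hp0.le, ← Real.rpow_add hp0]
        congr 1
        obtain ⟨n, rfl⟩ : ∃ n, h = n + 1 := ⟨h - 1, by omega⟩
        rw [Nat.add_sub_cancel, pow_succ]
        field_simp
        ring

variable {A : Type*} [NormedCommRing A] [NormedAlgebra ℚ_[p] A]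

theorem norm_pow_le_pow_mul_norm_one (v : A) (m : ℕ) : ‖v ^ m‖ ≤ ‖v‖ ^ m * ‖(1 : A)‖ := by
  induction m with
  | zero => simp
  | succ m ih =>
    rw [pow_succ', pow_succ', mul_assoc]
    exact (norm_mul_le _ _).trans (by gcongr)

theorem norm_coeff_pbinomPoly_smul_le {h : ℕ} (hh : 1 ≤ h) {v : A}
    (hv : ‖v‖ ≤ (p : ℝ) ^ (-(1 / (((p : ℝ) - 1) * (p : ℝ) ^ (h - 1))))) (b : ℤ_[p]) (m j : ℕ) :
    ‖(pbinomPoly b h m).coeff j • v ^ m‖ ≤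
      ((p : ℝ) ^ (-(1 / (p : ℝ) ^ h))) ^ m * ‖(1 : A)‖ := by
  refine (norm_smul_le _ _).trans ?_
  calc _ ≤ (p : ℝ) ^ padicValNat p (m / p ^ h).factorial * (‖v‖ ^ m * ‖(1 : A)‖) := by
        gcongr
        · exact norm_coeff_pbinomPoly_le b h m j
        · exact norm_pow_le_pow_mul_norm_one v m
    _ ≤ _ := by
        rw [← mul_assoc]
        gcongr
        exact pow_padicValNat_factorial_mul_pow_le hh (norm_nonneg v) hv m

theorem rpow_neg_one_div_pow_lt_one (h : ℕ) : (p : ℝ) ^ (-(1 / (p : ℝ) ^ h)) < 1 := by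
  have hp1 : (1 : ℝ) < p := by exact_mod_cast (Fact.out : p.Prime).one_lt
  exact Real.rpow_lt_one_of_one_lt_of_neg hp1 (neg_lt_zero.2 (by positivity))

variable [CompleteSpace A]

theorem summable_pbinom_smul_pow {h : ℕ} (hh : 1 ≤ h) {v : A}
    (hv : ‖v‖ ≤ (p : ℝ) ^ (-(1 / (((p : ℝ) - 1) * (p : ℝ) ^ (h - 1))))) (a : ℤ_[p]) :
    Summable fun m : ℕ => pbinom a m • v ^ m := by
  have hgeo := (summable_geometric_of_lt_one (by positivity)
    (rpow_neg_one_div_pow_lt_one (p := p) h)).mul_right ‖(1 : A)‖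
  refine Summable.of_norm_bounded hgeo fun m => ?_
  have heq : (pbinomPoly a h m).coeff 0 = pbinom a m := by
    simpa [Polynomial.coeff_zero_eq_eval_zero] using eval_pbinomPoly a 0 h m
  rw [← heq]
  exact norm_coeff_pbinomPoly_smul_le hh hv a m 0

/-- The double series obtained by expanding each `binom(b + p ^ h * t, m)` in powers of `t`. -/
theorem summable_pow_smul_coeff_pbinomPoly {h : ℕ} (hh : 1 ≤ h) {v : A}
    (hv : ‖v‖ ≤ (p : ℝ) ^ (-(1 / (((p : ℝ) - 1) * (p : ℝ) ^ (h - 1))))) (b t : ℤ_[p]) :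
    Summable fun x : ℕ × ℕ =>
      (t : ℚ_[p]) ^ x.2 • (pbinomPoly b h x.1).coeff x.2 • v ^ x.1 := by
  set r : ℝ := (p : ℝ) ^ (-(1 / (p : ℝ) ^ h)) with hr
  have hr0 : 0 ≤ r := by positivity
  have hr1 : r < 1 := rpow_neg_one_div_pow_lt_one h
  have hzero : ∀ m, ∀ j ∉ Finset.range (m + 1), (if j ≤ m then r ^ m * ‖(1 : A)‖ else 0) = 0 :=
    fun m j hj => if_neg (by simpa using hj)
  have hmajor : Summable fun x : ℕ × ℕ => if x.2 ≤ x.1 then r ^ x.1 * ‖(1 : A)‖ else 0 := by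
    rw [summable_prod_of_nonneg fun x => by dsimp only; split_ifs <;> simp; positivity]
    refine ⟨fun m => summable_of_ne_finset_zero (hzero m), ?_⟩
    have hsum : Summable fun m : ℕ => ((m : ℝ) ^ 1 * r ^ m + r ^ m) * ‖(1 : A)‖ :=
      ((summable_pow_mul_geometric_of_norm_lt_one 1
        (by rwa [Real.norm_of_nonneg hr0])).add
        (summable_geometric_of_lt_one hr0 hr1)).mul_right _
    refine hsum.congr fun m => ?_
    rw [tsum_eq_sum (hzero m), Finset.sum_congr rfl fun j hj =>
      if_pos (Nat.lt_succ_iff.1 (Finset.mem_range.1 hj)), Finset.sum_const, Finset.card_range,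
      nsmul_eq_mul]
    push_cast
    ring
  refine Summable.of_norm_bounded hmajor fun x => ?_
  split_ifs with hx
  · refine (norm_smul_le _ _).trans ?_
    have ht : ‖(t : ℚ_[p]) ^ x.2‖ ≤ 1 := by
      rw [norm_pow]
      exact pow_le_one₀ (norm_nonneg _) t.2
    exact (mul_le_of_le_one_left (norm_nonneg _) ht).trans
      (norm_coeff_pbinomPoly_smul_le hh hv b x.1 x.2)
  · rw [Polynomial.coeff_eq_zero_of_natDegree_lt
      ((natDegree_pbinomPoly_le b h x.1).trans_lt (not_le.1 hx))]
    simp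

theorem hasSum_pow_smul_tsum_coeff_pbinomPoly {h : ℕ} (hh : 1 ≤ h) {v : A}
    (hv : ‖v‖ ≤ (p : ℝ) ^ (-(1 / (((p : ℝ) - 1) * (p : ℝ) ^ (h - 1))))) (b t : ℤ_[p]) :
    HasSum (fun j : ℕ => (t : ℚ_[p]) ^ j • ∑' m, (pbinomPoly b h m).coeff j • v ^ m)
      (∑' m, pbinom (b + (p : ℤ_[p]) ^ h * t) m • v ^ m) := by
  have hsum := summable_pow_smul_coeff_pbinomPoly hh hv b t
  have hcol : ∀ j, Summable fun m => (pbinomPoly b h m).coeff j • v ^ m := fun j => by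
    simpa using (summable_pow_smul_coeff_pbinomPoly hh hv b 1).prod_symm.prod_factor j
  have hrow : ∀ m, HasSum (fun j => (t : ℚ_[p]) ^ j • (pbinomPoly b h m).coeff j • v ^ m)
      (pbinom (b + (p : ℤ_[p]) ^ h * t) m • v ^ m) := fun m => by
    rw [← eval_pbinomPoly,
      Polynomial.eval_eq_sum_range' (Nat.lt_succ_of_le (natDegree_pbinomPoly_le b h m)),
      Finset.sum_smul]
    simp only [smul_smul, mul_comm ((t : ℚ_[p]) ^ _)]
    refine hasSum_sum_of_ne_finset_zero fun j hj => ?_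
    rw [Polynomial.coeff_eq_zero_of_natDegree_lt
      ((natDegree_pbinomPoly_le b h m).trans_lt (by simpa using hj))]
    simp
  rw [(hsum.hasSum.prod_fiberwise hrow).tsum_eq]
  exact ((Equiv.prodComm ℕ ℕ).hasSum_iff.2 hsum.hasSum).prod_fiberwise
    fun j => (hcol j).hasSum.const_smul _

end PadicBinomial

/-- If `A` is a commutative `ℚ_p`-Banach algebra (nonarchimedean norm) and `v ∈ A`
satisfies `‖v‖ ≤ p^{−1/((p−1)p^{h−1})}` for some `h ≥ 1`, then (a) for every `a ∈ ℤ_p` the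
series `F(a) = Σ_m binom(a, m)·v^m` converges, and (b) `F` is analytic on every closed
disk of radius `p^{-h}`: for every `b ∈ ℤ_p` there is a sequence `w_j → 0` in `A` with
`F(b + p^h·t) = Σ_j w_j·t^j` for every `t ∈ ℤ_p`. -/
theorem stmt7 {p : ℕ} [Fact p.Prime]
    (A : Type*) [NormedCommRing A] [NormedAlgebra ℚ_[p] A] [CompleteSpace A]
    (hna : ∀ x y : A, ‖x + y‖ ≤ max ‖x‖ ‖y‖)
    (h : ℕ) (hh : 1 ≤ h) (v : A)
    (hv : ‖v‖ ≤ (p : ℝ) ^ (-(1 / (((p : ℝ) - 1) * (p : ℝ) ^ (h - 1))))) :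
    ∃ F : ℤ_[p] → A,
      (∀ a : ℤ_[p], HasSum (fun m : ℕ => pbinom a m • v ^ m) (F a)) ∧
      ∀ b : ℤ_[p], ∃ w : ℕ → A, Tendsto w atTop (nhds 0) ∧
        ∀ t : ℤ_[p], HasSum (fun j : ℕ => ((t : ℚ_[p]) ^ j) • w j)
          (F (b + (p : ℤ_[p]) ^ h * t)) := by
  refine ⟨fun a => ∑' m, pbinom a m • v ^ m,
    fun a => (summable_pbinom_smul_pow hh hv a).hasSum, fun b =>
    ⟨fun j => ∑' m, (pbinomPoly b h m).coeff j • v ^ m, ?_,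
      fun t => hasSum_pow_smul_tsum_coeff_pbinomPoly hh hv b t⟩⟩
  simpa using (hasSum_pow_smul_tsum_coeff_pbinomPoly hh hv b 1).summable.tendsto_atTop_zero
end
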